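/- arXiv:2011.03495 — 12 statements merged into one kernel-verified Lean document; each statement's English description precedes it below -/
import Mathlib

section
/- Let G = (V,E) be a finite bipartite graph with unsigned incidence matrix B, let d ∈ ℝ^V with d ≥ 0, and let x ∈ ℝ^E with x ≥ 0. Define d^x := Bᵀx, f := max(d^x − d, 0) entrywise, and for each edge e = (a,b) ∈ E set x̃_e := x_e · (1 − max(f_a/d^x_a, f_b/d^x_b)) (with the convention 0/0 = 0; when x_e > 0 both d^x_a and d^x_b are positive). Then x̃ satisfies: (i) 0 ≤ x̃ ≤ x entrywise; (ii) Bᵀx̃ ≤ d entrywise; and (iii) ‖x̃‖₁ ≥ ‖x‖₁ − Σ_{v∈V} max([Bᵀx]_v − d_v, 0). -/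
/-- **Overflow removal (Lemma `RemoveOverflow` correctness).**
`G = (V, E)` is a finite bipartite graph given by endpoint maps `ends : E → V × V`
(first endpoint in `L`, second outside `L`), with unsigned incidence matrix `B`.
Given nonnegative demands `d` and a nonnegative vector `x` on edges, setting
`dx := Bᵀx`, `f := max (dx - d) 0` and
`x̃_e := x_e * (1 - max (f_a / dx_a) (f_b / dx_b))` for `e = (a, b)`
(Lean's convention `0/0 = 0` is used), the vector `x̃` satisfies
`0 ≤ x̃ ≤ x`, `Bᵀx̃ ≤ d`, and `‖x̃‖₁ ≥ ‖x‖₁ - Σ_v max ([Bᵀx]_v - d_v) 0`. -/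
theorem stmt_0 {V E : Type*} [Fintype V] [Fintype E] [DecidableEq V]
    (ends : E → V × V) (L : Set V)
    (hbip : ∀ e, (ends e).1 ∈ L ∧ (ends e).2 ∉ L)
    (B : Matrix E V ℝ)
    (hB : ∀ e v, B e v = if v = (ends e).1 ∨ v = (ends e).2 then 1 else 0)
    (d : V → ℝ) (hd : ∀ v, 0 ≤ d v)
    (x : E → ℝ) (hx : ∀ e, 0 ≤ x e)
    (dx : V → ℝ) (hdx : ∀ v, dx v = ∑ e, B e v * x e)
    (f : V → ℝ) (hf : ∀ v, f v = max (dx v - d v) 0)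
    (xt : E → ℝ)
    (hxt : ∀ e, xt e =
      x e * (1 - max (f (ends e).1 / dx (ends e).1) (f (ends e).2 / dx (ends e).2))) :
    (∀ e, 0 ≤ xt e ∧ xt e ≤ x e) ∧
    (∀ v, ∑ e, B e v * xt e ≤ d v) ∧
    (∑ e, |x e|) - (∑ v, max ((∑ e, B e v * x e) - d v) 0) ≤ ∑ e, |xt e| := by
  have hB0 : ∀ e v, 0 ≤ B e v := fun e v => by rw [hB]; split_ifs <;> norm_num
  have hdx0 : ∀ v, 0 ≤ dx v := fun v => by
    rw [hdx]; exact Finset.sum_nonneg fun e _ => mul_nonneg (hB0 e v) (hx e)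
  have hf0 : ∀ v, 0 ≤ f v := fun v => by rw [hf]; exact le_max_right _ _
  have hfdx : ∀ v, f v ≤ dx v := fun v => by
    rw [hf]; exact max_le (by linarith [hd v]) (hdx0 v)
  have hr0 : ∀ v, 0 ≤ f v / dx v := fun v => div_nonneg (hf0 v) (hdx0 v)
  have hr1 : ∀ v, f v / dx v ≤ 1 := fun v => div_le_one_of_le₀ (hfdx v) (hdx0 v)
  have hrdx : ∀ v, f v / dx v * dx v = f v := fun v =>
    div_mul_cancel_of_imp fun h => le_antisymm (h ▸ hfdx v) (hf0 v)
  have hxt0 : ∀ e, 0 ≤ xt e := fun e => by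
    rw [hxt]
    exact mul_nonneg (hx e) (sub_nonneg.2 (max_le (hr1 _) (hr1 _)))
  refine ⟨fun e => ⟨hxt0 e, ?_⟩, fun v => ?_, ?_⟩
  · rw [hxt]
    exact mul_le_of_le_one_right (hx e) (sub_le_self _ ((hr0 _).trans (le_max_left _ _)))
  · calc ∑ e, B e v * xt e ≤ ∑ e, B e v * x e * (1 - f v / dx v) := by
          refine Finset.sum_le_sum fun e _ => ?_
          rw [hxt, hB]
          split_ifs with h
          · rw [one_mul, one_mul]
            refine mul_le_mul_of_nonneg_left (sub_le_sub_left ?_ 1) (hx e)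
            rcases h with rfl | rfl
            · exact le_max_left _ _
            · exact le_max_right _ _
          · simp
      _ = dx v - f v := by
          rw [← Finset.sum_mul, ← hdx]
          linarith [hrdx v]
      _ ≤ d v := by
          have h := le_max_left (dx v - d v) 0
          rw [← hf] at h
          linarith
  · have hmax : ∀ e, max (f (ends e).1 / dx (ends e).1) (f (ends e).2 / dx (ends e).2) ≤
        ∑ v, B e v * (f v / dx v) := fun e => by
      have hle : ∀ w, B e w = 1 → f w / dx w ≤ ∑ v, B e v * (f v / dx v) := fun w hw => by
        simpa [hw] using Finset.single_le_sum (f := fun v => B e v * (f v / dx v))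
          (fun v _ => mul_nonneg (hB0 e v) (hr0 v)) (Finset.mem_univ w)
      exact max_le (hle _ (by simp [hB])) (hle _ (by simp [hB]))
    have hsum : ∑ e, x e * ∑ v, B e v * (f v / dx v) = ∑ v, f v := by
      simp_rw [Finset.mul_sum]
      rw [Finset.sum_comm]
      refine Finset.sum_congr rfl fun v _ => ?_
      calc ∑ e, x e * (B e v * (f v / dx v)) = f v / dx v * ∑ e, B e v * x e := by
            rw [Finset.mul_sum]
            exact Finset.sum_congr rfl fun e _ => by ring
        _ = f v := by rw [← hdx, hrdx]
    simp_rw [abs_of_nonneg (hx _), abs_of_nonneg (hxt0 _), ← hdx, ← hf]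
    rw [← hsum, ← Finset.sum_sub_distrib]
    refine Finset.sum_le_sum fun e _ => ?_
    rw [hxt, mul_sub, mul_one]
    exact sub_le_sub_left (mul_le_mul_of_nonneg_left (hmax e) (hx e)) _
end

section
/- Let G = (V,E) be a finite bipartite graph with unsigned incidence matrix B, let w ∈ ℝ^E with w ≥ 0, let d ∈ ℝ^V with d ≥ 0, and let M* := max{⟨w,z⟩ : z ∈ ℝ^E, z ≥ 0, Bᵀz ≤ d} be the maximum-weight fractional matching value. Suppose x̂ ∈ ℝ^E with x̂ ≥ 0 satisfies ⟨w, x̂⟩ − ‖w‖_∞ · Σ_{v∈V} max([Bᵀx̂]_v − d_v, 0) ≥ M* − ε for some ε ≥ 0. Define x̃ from x̂ by the overflow-removal formula: d^{x̂} := Bᵀx̂, f := max(d^{x̂} − d, 0), and x̃_e := x̂_e · (1 − max(f_a/d^{x̂}_a, f_b/d^{x̂}_b)) for e = (a,b) ∈ E (convention 0/0 = 0). Then 0 ≤ x̃ ≤ x̂ entrywise, Bᵀx̃ ≤ d entrywise, and ⟨w, x̃⟩ ≥ M* − ε. -/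
/-- **Weighted overflow removal.**
`G = (V, E)` is a finite bipartite graph with unsigned incidence matrix `B`,
nonnegative weights `w` and nonnegative demands `d`.  `Mstar` is the maximum
weight of a fractional matching (`IsGreatest` of the set of attainable values
`⟨w, z⟩` over `z ≥ 0` with `Bᵀz ≤ d`), and `wmax = ‖w‖_∞`.  If the nonnegative
`x̂` satisfies `⟨w, x̂⟩ - ‖w‖_∞ · Overflow_d(x̂) ≥ Mstar - ε`, then the
overflow-removal output `x̃` satisfies `0 ≤ x̃ ≤ x̂`, `Bᵀx̃ ≤ d`, and
`⟨w, x̃⟩ ≥ Mstar - ε`. -/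
theorem stmt_1 {V E : Type*} [Fintype V] [Fintype E] [DecidableEq V]
    (ends : E → V × V) (L : Set V)
    (hbip : ∀ e, (ends e).1 ∈ L ∧ (ends e).2 ∉ L)
    (B : Matrix E V ℝ)
    (hB : ∀ e v, B e v = if v = (ends e).1 ∨ v = (ends e).2 then 1 else 0)
    (w : E → ℝ) (hw : ∀ e, 0 ≤ w e)
    (d : V → ℝ) (hd : ∀ v, 0 ≤ d v)
    (wmax : ℝ) (hwmax : IsGreatest (Set.range fun e => |w e|) wmax)
    (Mstar : ℝ)
    (hMstar : IsGreatest {val | ∃ z : E → ℝ, (∀ e, 0 ≤ z e) ∧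
      (∀ v, ∑ e, B e v * z e ≤ d v) ∧ val = ∑ e, w e * z e} Mstar)
    (ε : ℝ) (hε : 0 ≤ ε)
    (xh : E → ℝ) (hxh : ∀ e, 0 ≤ xh e)
    (hnear : Mstar - ε ≤
      (∑ e, w e * xh e) - wmax * ∑ v, max ((∑ e, B e v * xh e) - d v) 0)
    (dx : V → ℝ) (hdx : ∀ v, dx v = ∑ e, B e v * xh e)
    (f : V → ℝ) (hf : ∀ v, f v = max (dx v - d v) 0)
    (xt : E → ℝ)
    (hxt : ∀ e, xt e =
      xh e * (1 - max (f (ends e).1 / dx (ends e).1) (f (ends e).2 / dx (ends e).2))) :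
    (∀ e, 0 ≤ xt e ∧ xt e ≤ xh e) ∧
    (∀ v, ∑ e, B e v * xt e ≤ d v) ∧
    Mstar - ε ≤ ∑ e, w e * xt e := by
  have hBnn : ∀ e v, 0 ≤ B e v := fun e v => by rw [hB]; split_ifs <;> norm_num
  have hdxnn : ∀ v, 0 ≤ dx v := fun v => by
    rw [hdx]
    exact Finset.sum_nonneg fun e _ => mul_nonneg (hBnn e v) (hxh e)
  have hfnn : ∀ v, 0 ≤ f v := fun v => by rw [hf]; exact le_max_right _ _
  have hfle : ∀ v, f v ≤ dx v := fun v => by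
    rw [hf]
    exact max_le (by linarith [hd v]) (hdxnn v)
  have hdf : ∀ v, dx v - f v ≤ d v := fun v => by
    have : dx v - d v ≤ f v := by rw [hf]; exact le_max_left _ _
    linarith
  obtain ⟨r, hr⟩ : ∃ r : V → ℝ, ∀ v, r v = f v / dx v := ⟨_, fun _ => rfl⟩
  simp only [← hr] at hxt
  have hr0 : ∀ v, 0 ≤ r v := fun v => by rw [hr]; exact div_nonneg (hfnn v) (hdxnn v)
  have hr1 : ∀ v, r v ≤ 1 := fun v => by rw [hr]; exact div_le_one_of_le₀ (hfle v) (hdxnn v)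
  have hrdx : ∀ v, r v * dx v = f v := fun v => by
    rw [hr]
    refine div_mul_cancel_of_imp fun h => le_antisymm ?_ (hfnn v)
    rw [← h]
    exact hfle v
  refine ⟨fun e => ?_, fun v => ?_, ?_⟩
  · have h1 := max_le (hr1 (ends e).1) (hr1 (ends e).2)
    have h0 := le_max_of_le_left (c := r (ends e).2) (hr0 (ends e).1)
    rw [hxt]
    exact ⟨mul_nonneg (hxh e) (by linarith), mul_le_of_le_one_right (hxh e) (by linarith)⟩
  · calc ∑ e, B e v * xt e ≤ ∑ e, (B e v * xh e) * (1 - r v) := by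
          refine Finset.sum_le_sum fun e _ => ?_
          rw [hxt, ← mul_assoc]
          by_cases hv : v = (ends e).1 ∨ v = (ends e).2
          · refine mul_le_mul_of_nonneg_left (sub_le_sub_left ?_ 1)
              (mul_nonneg (hBnn e v) (hxh e))
            rcases hv with rfl | rfl
            · exact le_max_left _ _
            · exact le_max_right _ _
          · simp [hB, hv]
      _ = dx v - f v := by rw [← Finset.sum_mul, ← hdx, ← hrdx]; ring
      _ ≤ d v := hdf v
  · have hmax : ∀ e, max (r (ends e).1) (r (ends e).2) ≤ ∑ v, B e v * r v := fun e => by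
      have hterm : ∀ u, B e u = 1 → r u ≤ ∑ v, B e v * r v := fun u hu => by
        have := Finset.single_le_sum (f := fun v => B e v * r v)
          (fun v _ => mul_nonneg (hBnn e v) (hr0 v)) (Finset.mem_univ u)
        simpa [hu] using this
      exact max_le (hterm _ (by simp [hB])) (hterm _ (by simp [hB]))
    have hwle : ∀ e, w e ≤ wmax := fun e => (le_abs_self _).trans (hwmax.2 ⟨e, rfl⟩)
    have hover : ∑ e, xh e * ∑ v, B e v * r v = ∑ v, f v := by
      simp_rw [Finset.mul_sum]
      rw [Finset.sum_comm]
      refine Finset.sum_congr rfl fun v _ => ?_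
      rw [← hrdx, hdx, Finset.mul_sum]
      exact Finset.sum_congr rfl fun e _ => by ring
    have hloss : ∑ e, w e * xh e - wmax * ∑ v, f v ≤ ∑ e, w e * xt e := by
      rw [← hover, Finset.mul_sum, ← Finset.sum_sub_distrib]
      refine Finset.sum_le_sum fun e _ => ?_
      have hS := Finset.sum_nonneg fun v (_ : v ∈ Finset.univ) =>
        mul_nonneg (hBnn e v) (hr0 v)
      have h1 := mul_le_mul_of_nonneg_left (hmax e) (mul_nonneg (hw e) (hxh e))
      have h2 := mul_le_mul_of_nonneg_right (hwle e) (mul_nonneg (hxh e) hS)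
      rw [hxt]
      linarith
    simp only [← hdx, ← hf] at hnear
    exact hnear.trans hloss
end

section
/- Let G = (V,E) be a finite bipartite graph and let M* := max{‖z‖₁ : z ∈ ℝ^E, z ≥ 0, Bᵀz ≤ 1} be its fractional maximum matching value (which for bipartite graphs equals the maximum cardinality matching size). Form the extended graph G̃ = (Ṽ, Ẽ) with two new vertices joined by one new edge e₀, incidence matrix B̃ agreeing with B on rows indexed by E and having a zero row for e₀, and demand vector d_MCM ∈ {0,1}^Ṽ equal to 1 on V and 0 on the new vertices. Then for any M > 0 with M* ≤ 2M, the minimum over x ∈ Δ^Ẽ of −2M‖x_E‖₁ + Σ_{v∈Ṽ} max([B̃ᵀ(2Mx)]_v − (d_MCM)_v, 0) equals −M*. -/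
/-- Scaling down each edge by the relative overflow of the vertices it meets turns a nonnegative
weighting `z` into a fractional matching, and loses at most the total overflow. -/
theorem exists_feasible_sub_overflow_le {V E : Type*} [Fintype V] [Fintype E]
    (B : Matrix E V ℝ) (hB : ∀ e v, B e v = 0 ∨ B e v = 1) (z : E → ℝ) (hz : ∀ e, 0 ≤ z e) :
    ∃ y : E → ℝ, (∀ e, 0 ≤ y e) ∧ (∀ v, ∑ e, B e v * y e ≤ 1) ∧
      ∑ e, z e - ∑ v, max (∑ e, B e v * z e - 1) 0 ≤ ∑ e, y e := by
  have hB0 : ∀ e v, 0 ≤ B e v := fun e v => by rcases hB e v with h | h <;> simp [h]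
  set d : V → ℝ := fun v => ∑ e, B e v * z e with hd
  have hd0 : ∀ v, 0 ≤ d v := fun v => Finset.sum_nonneg fun e _ => mul_nonneg (hB0 e v) (hz e)
  set a : V → ℝ := fun v => max (d v - 1) 0 / d v with ha
  have ha0 : ∀ v, 0 ≤ a v := fun v => div_nonneg (le_max_right _ _) (hd0 v)
  have hda : ∀ v, d v * a v = max (d v - 1) 0 := by
    intro v
    rcases (hd0 v).eq_or_lt with h | h
    · simp [← h]
    · exact mul_div_cancel₀ _ h.ne'
  have ha1 : ∀ v, a v ≤ 1 := fun v =>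
    div_le_one_of_le₀ (max_le (by linarith) (hd0 v)) (hd0 v)
  refine ⟨fun e => z e * max (1 - ∑ v, B e v * a v) 0,
    fun e => mul_nonneg (hz e) (le_max_right _ _), fun v => ?_, ?_⟩
  · calc ∑ e, B e v * (z e * max (1 - ∑ w, B e w * a w) 0)
        ≤ ∑ e, B e v * z e * (1 - a v) := by
          refine Finset.sum_le_sum fun e _ => ?_
          rcases hB e v with h | h
          · simp [h]
          · have hle : B e v * a v ≤ ∑ w, B e w * a w :=
              Finset.single_le_sum (f := fun w => B e w * a w)
                (fun w _ => mul_nonneg (hB0 e w) (ha0 w)) (Finset.mem_univ v)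
            rw [h, one_mul] at hle
            rw [h, one_mul, one_mul]
            exact mul_le_mul_of_nonneg_left
              (max_le (by linarith) (by linarith [ha1 v])) (hz e)
      _ = d v - d v * a v := by rw [← Finset.sum_mul]; ring
      _ ≤ 1 := by rw [hda]; linarith [le_max_left (d v - 1) 0]
  · calc ∑ e, z e - ∑ v, max (d v - 1) 0
        = ∑ e, z e * (1 - ∑ v, B e v * a v) := by
          simp_rw [← hda, mul_sub, mul_one, Finset.sum_sub_distrib, hd, Finset.sum_mul,
            Finset.mul_sum]
          rw [Finset.sum_comm]
          congr 1
          exact Finset.sum_congr rfl fun e _ => Finset.sum_congr rfl fun v _ => by ring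
      _ ≤ ∑ e, z e * max (1 - ∑ v, B e v * a v) 0 :=
          Finset.sum_le_sum fun e _ => mul_le_mul_of_nonneg_left (le_max_left _ _) (hz e)


/-- **The overflow objective attains the value `-M*`.**
`G = (V, E)` is a finite bipartite graph with unsigned incidence matrix `B`, and
`Mstar` is its fractional maximum matching value (`IsGreatest` of `{‖z‖₁ : z ≥ 0, Bᵀz ≤ 1}`).
On the extended graph (one extra edge `Sum.inr ()`, two extra vertices, incidence
matrix `Bt`, demands `dMCM` equal to `1` on `V` and `0` on the extra vertices), for any
`M > 0` with `Mstar ≤ 2M`, the minimum over the simplex of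
`x ↦ -2M‖x_E‖₁ + Σ_v max ([Btᵀ(2Mx)]_v - dMCM_v) 0` is attained and equals `-Mstar`. -/
theorem stmt_3 {V E : Type*} [Fintype V] [Fintype E] [DecidableEq V]
    (ends : E → V × V) (L : Set V)
    (hbip : ∀ e, (ends e).1 ∈ L ∧ (ends e).2 ∉ L)
    (B : Matrix E V ℝ)
    (hB : ∀ e v, B e v = if v = (ends e).1 ∨ v = (ends e).2 then 1 else 0)
    (Bt : Matrix (E ⊕ Unit) (V ⊕ Bool) ℝ)
    (hBt1 : ∀ e v, Bt (Sum.inl e) (Sum.inl v) = B e v)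
    (hBt2 : ∀ e b', Bt (Sum.inl e) (Sum.inr b') = 0)
    (hBt3 : ∀ vt, Bt (Sum.inr ()) vt = 0)
    (dMCM : V ⊕ Bool → ℝ)
    (hdMCM : ∀ v, dMCM (Sum.inl v) = 1) (hdMCM' : ∀ b', dMCM (Sum.inr b') = 0)
    (Mstar : ℝ)
    (hMstar : IsGreatest {val | ∃ z : E → ℝ, (∀ e, 0 ≤ z e) ∧
      (∀ v, ∑ e, B e v * z e ≤ 1) ∧ val = ∑ e, |z e|} Mstar)
    (M : ℝ) (hM : 0 < M) (hM2 : Mstar ≤ 2 * M)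
    (F₁ : (E ⊕ Unit → ℝ) → ℝ)
    (hF₁ : ∀ x, F₁ x = -(2 * M) * (∑ e : E, |x (Sum.inl e)|)
        + ∑ v : V ⊕ Bool, max ((∑ et, Bt et v * (2 * M * x et)) - dMCM v) 0) :
    IsLeast (F₁ '' stdSimplex ℝ (E ⊕ Unit)) (-Mstar) := by
  have hB01 : ∀ e v, B e v = 0 ∨ B e v = 1 := fun e v => by
    rw [hB]; split_ifs <;> simp
  have hF : ∀ x, (∀ e, 0 ≤ x (Sum.inl e)) → F₁ x = -(∑ e, 2 * M * x (Sum.inl e))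
      + ∑ v, max (∑ e, B e v * (2 * M * x (Sum.inl e)) - 1) 0 := by
    intro x hx
    have habs : ∀ e, |x (Sum.inl e)| = x (Sum.inl e) := fun e => abs_of_nonneg (hx e)
    simp [hF₁, Fintype.sum_sum_type, hBt1, hBt2, hBt3, hdMCM, hdMCM', habs, Finset.mul_sum]
  obtain ⟨⟨z, hz, hzB, hzM⟩, hub⟩ := hMstar
  have hzM' : Mstar = ∑ e, z e := by simp_rw [hzM, abs_of_nonneg (hz _)]
  have h2M : 0 < 2 * M := by positivity
  constructor
  · set x : E ⊕ Unit → ℝ := Sum.elim (fun e => z e / (2 * M)) (fun _ => 1 - Mstar / (2 * M))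
    have hx : ∀ e, 2 * M * x (Sum.inl e) = z e := fun e => mul_div_cancel₀ _ h2M.ne'
    have hx0 : ∀ e, 0 ≤ x (Sum.inl e) := fun e => div_nonneg (hz e) h2M.le
    refine ⟨x, ⟨?_, ?_⟩, ?_⟩
    · rintro (e | u)
      · exact hx0 e
      · exact sub_nonneg.2 (div_le_one_of_le₀ hM2 h2M.le)
    · simp [x, Fintype.sum_sum_type, ← Finset.sum_div, ← hzM']
    · rw [hF x hx0]
      simp_rw [hx]
      rw [Finset.sum_eq_zero fun v _ => max_eq_right (sub_nonpos.2 (hzB v)), hzM', add_zero]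
  · rintro _ ⟨x, hx, rfl⟩
    obtain ⟨y, hy0, hyB, hy⟩ := exists_feasible_sub_overflow_le B hB01
      (fun e => 2 * M * x (Sum.inl e)) fun e => mul_nonneg h2M.le (hx.1 _)
    have hyM : ∑ e, y e ≤ Mstar :=
      hub ⟨y, hy0, hyB, by simp_rw [abs_of_nonneg (hy0 _)]⟩
    rw [hF x fun e => hx.1 _]
    linarith
end

section
/- Let A ∈ ℝ^{m×n}, b ∈ ℝ^n, c ∈ ℝ^m, and define ‖A‖_∞ := max_{i∈[m]} Σ_{j∈[n]} |A_{ij}|. Suppose x ∈ Δ^m has x_i > 0 for some index i with c_i > min_{i'∈[m]} c_{i'} + 2‖A‖_∞. Let i* be a minimizing index of c, and define x̃ ∈ Δ^m by x̃ = x except x̃_{i*} = x_{i*} + x_i and x̃_i = 0. Then cᵀx̃ + ‖Aᵀx̃ − b‖₁ < cᵀx + ‖Aᵀx − b‖₁. In particular, any minimizer of x ↦ cᵀx + ‖Aᵀx − b‖₁ over Δ^m is supported on coordinates i with c_i ≤ min_{i'} c_{i'} + 2‖A‖_∞. -/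
/-- Moving the mass at `i` to `k` changes a linear functional by `(f k - f i) * x i`. -/
theorem sum_mul_update_update {m : Type*} [Fintype m] [DecidableEq m] (f x : m → ℝ) {i k : m}
    (hik : i ≠ k) :
    ∑ l, f l * Function.update (Function.update x i 0) k (x k + x i) l =
      ∑ l, f l * x l + (f k - f i) * x i := by
  have h : Function.update (Function.update x i 0) k (x k + x i) =
      x + Pi.single k (x i) - Pi.single i (x i) := by
    ext l
    by_cases hk : l = k
    · subst hk
      simp [hik.symm]
    · by_cases hi : l = i
      · subst hi
        simp [hk]
      · simp [hk, hi]
  simp only [h, Pi.add_apply, Pi.sub_apply, mul_add, mul_sub, Finset.sum_add_distrib,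
    Finset.sum_sub_distrib, Pi.single_apply, mul_ite, mul_zero, Finset.sum_ite_eq',
    Finset.mem_univ, if_true]
  ring

/-- Moving the mass at `i` to `k` stays in the simplex. -/
theorem update_update_mem_stdSimplex {m : Type*} [Fintype m] [DecidableEq m] {x : m → ℝ}
    (hx : x ∈ stdSimplex ℝ m) {i k : m} (hik : i ≠ k) :
    Function.update (Function.update x i 0) k (x k + x i) ∈ stdSimplex ℝ m := by
  refine ⟨fun l => ?_, ?_⟩
  · have := hx.1 l
    have := hx.1 k
    have := hx.1 i
    simp only [Function.update_apply]
    split_ifs <;> linarith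
  · have h := sum_mul_update_update (fun _ => 1) x hik
    simp only [one_mul, sub_self, zero_mul, add_zero] at h
    exact h.trans hx.2

/-- **Mass on expensive coordinates can be moved to the cheapest coordinate.**
For `A ∈ ℝ^{m×n}`, `b`, `c`, with `Anorm = ‖A‖_∞` (the largest row `ℓ₁` norm) and `istar`
a minimizing index of `c`: if `x` is in the simplex and puts positive mass on a coordinate
`i` with `c_i > c_{istar} + 2‖A‖_∞`, then moving that mass to `istar` strictly decreases the
objective `z ↦ cᵀz + ‖Aᵀz - b‖₁`.  In particular any minimizer of this objective over the
simplex is supported on coordinates `i` with `c_i ≤ c_{istar} + 2‖A‖_∞`. -/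
theorem stmt_4 {m n : Type*} [Fintype m] [Fintype n] [DecidableEq m] [Nonempty m]
    (A : Matrix m n ℝ) (b : n → ℝ) (c : m → ℝ)
    (Anorm : ℝ) (hAnorm : IsGreatest (Set.range fun i => ∑ j, |A i j|) Anorm)
    (istar : m) (histar : ∀ i', c istar ≤ c i')
    (obj : (m → ℝ) → ℝ)
    (hobj : ∀ z, obj z = (∑ i, c i * z i) + ∑ j, |(∑ i, A i j * z i) - b j|) :
    (∀ x ∈ stdSimplex ℝ m, ∀ i, 0 < x i → c istar + 2 * Anorm < c i →
      obj (Function.update (Function.update x i 0) istar (x istar + x i)) < obj x) ∧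
    (∀ y ∈ stdSimplex ℝ m, (∀ x' ∈ stdSimplex ℝ m, obj y ≤ obj x') →
      ∀ i, y i ≠ 0 → c i ≤ c istar + 2 * Anorm) := by
  have hrow : ∀ i, ∑ j, |A i j| ≤ Anorm := fun i => hAnorm.2 ⟨i, rfl⟩
  have hnonneg : 0 ≤ Anorm := (Finset.sum_nonneg fun j _ => abs_nonneg _).trans (hrow istar)
  have hne : ∀ i, c istar + 2 * Anorm < c i → i ≠ istar := by
    rintro i hi rfl
    linarith
  have hdecr : ∀ x : m → ℝ, ∀ i, 0 < x i → c istar + 2 * Anorm < c i →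
      obj (Function.update (Function.update x i 0) istar (x istar + x i)) < obj x := by
    intro x i hxi hci
    rw [hobj, hobj, sum_mul_update_update c x (hne i hci)]
    have hbound : ∑ j, |(∑ l, A l j *
          Function.update (Function.update x i 0) istar (x istar + x i) l) - b j| ≤
        ∑ j, (|(∑ l, A l j * x l) - b j| + (|A istar j| + |A i j|) * x i) := by
      refine Finset.sum_le_sum fun j _ => ?_
      rw [sum_mul_update_update (fun l => A l j) x (hne i hci), add_sub_right_comm]
      refine (abs_add_le _ _).trans ?_
      rw [abs_mul, abs_of_pos hxi]
      gcongr
      exact abs_sub _ _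
    rw [Finset.sum_add_distrib, ← Finset.sum_mul, Finset.sum_add_distrib] at hbound
    have hrows := mul_le_mul_of_nonneg_right (add_le_add (hrow istar) (hrow i)) hxi.le
    have hgap := mul_lt_mul_of_pos_right hci hxi
    linarith
  refine ⟨fun x _ => hdecr x, fun y hy hmin i hyi => ?_⟩
  by_contra! hci
  exact (hdecr y i ((hy.1 i).lt_of_ne' hyi) hci).not_ge
    (hmin _ (update_update_mem_stdSimplex hy (hne i hci)))
end

section
/- Let A ∈ ℝ^{m×n} and b ∈ ℝ^n, and let ‖A‖_∞ := max_{i∈[m]} Σ_{j∈[n]} |A_{ij}|. Define b' ∈ ℝ^n by b'_j := min(max(b_j, −‖A‖_∞), ‖A‖_∞) (entrywise truncation of b to [−‖A‖_∞, ‖A‖_∞]). Then for every x ∈ Δ^m, ‖Aᵀx − b‖₁ = ‖Aᵀx − b'‖₁ + Σ_{j∈[n]} max(|b_j| − ‖A‖_∞, 0). In particular this truncation changes the objective x ↦ cᵀx + ‖Aᵀx − b‖₁ on Δ^m only by an additive constant independent of x. -/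
/-- Truncating `b` to an interval `[-N, N]` containing `t` changes `|t - b|` by `max (|b| - N) 0`. -/
lemma abs_sub_eq_abs_sub_truncation_add {t b N : ℝ} (ht : |t| ≤ N) :
    |t - b| = |t - min (max b (-N)) N| + max (|b| - N) 0 := by
  obtain ⟨hl, hu⟩ := abs_le.mp ht
  rcases le_total b (-N) with hb | hb
  · rw [max_eq_right hb, min_eq_left (by linarith), abs_of_nonneg (by linarith : 0 ≤ t - b),
      abs_of_nonneg (by linarith : 0 ≤ t - -N), abs_of_nonpos (by linarith : b ≤ 0),
      max_eq_left (by linarith)]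
    ring
  · rw [max_eq_left hb]
    rcases le_total b N with hb' | hb'
    · rw [min_eq_left hb', max_eq_right (sub_nonpos.mpr (abs_le.mpr ⟨hb, hb'⟩)), add_zero]
    · rw [min_eq_right hb', abs_of_nonpos (by linarith : t - b ≤ 0),
        abs_of_nonpos (by linarith : t - N ≤ 0), abs_of_nonneg (by linarith : 0 ≤ b),
        max_eq_left (by linarith)]
      ring

/-- A convex combination of reals bounded by `N` in absolute value is bounded by `N`. -/
lemma abs_sum_mul_le_of_mem_stdSimplex {m : Type*} [Fintype m] {a x : m → ℝ} {N : ℝ}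
    (ha : ∀ i, |a i| ≤ N) (hx : x ∈ stdSimplex ℝ m) : |∑ i, a i * x i| ≤ N :=
  calc |∑ i, a i * x i| ≤ ∑ i, |a i * x i| := Finset.abs_sum_le_sum_abs _ _
    _ ≤ ∑ i, N * x i := Finset.sum_le_sum fun i _ => by
      rw [abs_mul, abs_of_nonneg (hx.1 i)]
      exact mul_le_mul_of_nonneg_right (ha i) (hx.1 i)
    _ = N := by rw [← Finset.mul_sum, hx.2, mul_one]

/-- **Truncating `b` to `[-‖A‖_∞, ‖A‖_∞]` shifts the `ℓ₁` residual by a constant.**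
For `A ∈ ℝ^{m×n}`, `b ∈ ℝ^n`, `Anorm = ‖A‖_∞` (largest row `ℓ₁` norm) and the entrywise
truncation `b'_j = min (max (b_j) (-‖A‖_∞)) ‖A‖_∞`, every `x` in the simplex satisfies
`‖Aᵀx - b‖₁ = ‖Aᵀx - b'‖₁ + Σ_j max (|b_j| - ‖A‖_∞) 0`; in particular the objective
`x ↦ cᵀx + ‖Aᵀx - b‖₁` changes only by an additive constant independent of `x`. -/
theorem stmt_5 {m n : Type*} [Fintype m] [Fintype n] [Nonempty m]
    (A : Matrix m n ℝ) (b : n → ℝ)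
    (Anorm : ℝ) (hAnorm : IsGreatest (Set.range fun i => ∑ j, |A i j|) Anorm)
    (b' : n → ℝ) (hb' : ∀ j, b' j = min (max (b j) (-Anorm)) Anorm) :
    (∀ x ∈ stdSimplex ℝ m,
      (∑ j, |(∑ i, A i j * x i) - b j|) =
        (∑ j, |(∑ i, A i j * x i) - b' j|) + ∑ j, max (|b j| - Anorm) 0) ∧
    (∀ c : m → ℝ, ∀ x ∈ stdSimplex ℝ m,
      (∑ i, c i * x i) + ∑ j, |(∑ i, A i j * x i) - b j| =
        ((∑ i, c i * x i) + ∑ j, |(∑ i, A i j * x i) - b' j|)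
          + ∑ j, max (|b j| - Anorm) 0) := by
  have residual_eq : ∀ x ∈ stdSimplex ℝ m,
      (∑ j, |(∑ i, A i j * x i) - b j|) =
        (∑ j, |(∑ i, A i j * x i) - b' j|) + ∑ j, max (|b j| - Anorm) 0 := by
    intro x hx
    rw [← Finset.sum_add_distrib]
    refine Finset.sum_congr rfl fun j _ => ?_
    rw [hb' j]
    refine abs_sub_eq_abs_sub_truncation_add (abs_sum_mul_le_of_mem_stdSimplex (fun i => ?_) hx)
    exact (Finset.single_le_sum (f := fun j => |A i j|) (fun _ _ => abs_nonneg _)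
      (Finset.mem_univ j)).trans (hAnorm.2 ⟨i, rfl⟩)
  exact ⟨residual_eq, fun c x hx => by rw [residual_eq x hx, add_assoc]⟩
end

section
/- Let G = (V,E) be a finite bipartite graph with bipartition V = L ∪ R and unsigned incidence matrix B. Let x ∈ ℝ^E with x ≥ 0, ‖x‖₁ = M > 0, and Σ_{v∈V} max([Bᵀx]_v − 1, 0) ≤ εM for some ε ≥ 0. Define the matrix X ∈ ℝ^{L×R} by X_{uv} = x_e if e = (u,v) ∈ E and X_{uv} = 0 otherwise. Let X' be obtained from X by multiplying each row u by min(1, 1/Σ_{v'} X_{uv'}) (factor 1 if the row sum is 0), and let X̃ be obtained from X' by multiplying each column v by min(1, 1/Σ_{u'} X'_{u'v}) (factor 1 if the column sum is 0). Let x̃ ∈ ℝ^E be given by x̃_{(u,v)} = X̃_{uv}. Then x̃ has the same support as x, Bᵀx̃ ≤ 1 entrywise (x̃ is a feasible fractional matching), and ‖x̃ − x‖₁ ≤ 2εM. -/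
/-- The value `f` of a rescaling factor `min 1 (1 / s)`, with value `1` at `s = 0`, lies in
`(0, 1]`, brings `s` down to at most `1`, and removes exactly the excess of `s` over `1`. -/
theorem capFactor_spec {s f : ℝ} (hs : 0 ≤ s) (h0 : s = 0 → f = 1)
    (h1 : s ≠ 0 → f = min 1 (1 / s)) :
    0 < f ∧ f ≤ 1 ∧ f * s ≤ 1 ∧ s - f * s = max (s - 1) 0 := by
  rcases hs.eq_or_lt with h | h
  · rw [h0 h.symm, ← h]
    norm_num
  · rw [h1 h.ne']
    rcases le_total s 1 with hle | hle
    · rw [min_eq_left ((one_le_div h).2 hle), max_eq_right (by linarith)]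
      exact ⟨one_pos, le_rfl, by linarith, by ring⟩
    · rw [min_eq_right ((div_le_one h).2 hle), max_eq_left (by linarith),
        one_div_mul_cancel h.ne']
      exact ⟨by positivity, (div_le_one h).2 hle, le_rfl, rfl⟩

/-- Summing a function over all fibres of `p` gives its total sum. -/
theorem sum_sum_ite_fiber {V E : Type*} [Fintype V] [Fintype E] [DecidableEq V]
    (p : E → V) (w : E → ℝ) :
    (∑ v, ∑ e, if p e = v then w e else 0) = ∑ e, w e := by
  rw [Finset.sum_comm]
  simp

/-- A factor constant on the fibres of `p` can be pulled out of a fibre sum. -/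
theorem sum_ite_fiber_mul {V E : Type*} [Fintype E] [DecidableEq V]
    (p : E → V) (f : V → ℝ) (w : E → ℝ) (v : V) :
    (∑ e, if p e = v then f (p e) * w e else 0) = f v * ∑ e, if p e = v then w e else 0 := by
  rw [Finset.mul_sum]
  refine Finset.sum_congr rfl fun e _ => ?_
  split_ifs with h
  · rw [h]
  · rw [mul_zero]

/-- Fibre sums are monotone. -/
theorem sum_ite_fiber_mono {V E : Type*} [Fintype E] [DecidableEq V]
    (p : E → V) {w y : E → ℝ} (h : ∀ e, w e ≤ y e) (v : V) :
    (∑ e, if p e = v then w e else 0) ≤ ∑ e, if p e = v then y e else 0 := by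
  refine Finset.sum_le_sum fun e _ => ?_
  split_ifs
  exacts [h e, le_rfl]

/-- Rescaling a nonnegative weight on each fibre of `p` so that fibre sums are capped at `1`:
the result `y` is nonnegative, dominated by `w`, has the same support, is feasible, and the
mass removed is the total overflow. -/
theorem capFibers_spec {V E : Type*} [Fintype V] [Fintype E] [DecidableEq V]
    (p : E → V) (w : E → ℝ) (hw : ∀ e, 0 ≤ w e)
    (s : V → ℝ) (hs : ∀ v, s v = ∑ e, if p e = v then w e else 0)
    (f : V → ℝ) (h0 : ∀ v, s v = 0 → f v = 1) (h1 : ∀ v, s v ≠ 0 → f v = min 1 (1 / s v))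
    (y : E → ℝ) (hy : ∀ e, y e = f (p e) * w e) :
    (∀ e, 0 ≤ y e) ∧ (∀ e, y e ≤ w e) ∧ (∀ e, y e = 0 ↔ w e = 0) ∧
    (∀ v, (∑ e, if p e = v then y e else 0) ≤ 1) ∧
    (∑ e, (w e - y e)) = ∑ v, max ((∑ e, if p e = v then w e else 0) - 1) 0 := by
  have hs0 : ∀ v, 0 ≤ s v := fun v => by
    rw [hs]
    exact Finset.sum_nonneg fun e _ => by
      split_ifs
      exacts [hw e, le_rfl]
  have hf := fun v => capFactor_spec (hs0 v) (h0 v) (h1 v)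
  have hsum : ∀ v, (∑ e, if p e = v then y e else 0) = f v * s v := fun v => by
    simp only [hy]
    rw [sum_ite_fiber_mul, hs]
  refine ⟨fun e => ?_, fun e => ?_, fun e => ?_, fun v => ?_, ?_⟩
  · rw [hy]
    exact mul_nonneg (hf _).1.le (hw e)
  · rw [hy]
    exact mul_le_of_le_one_left (hw e) (hf _).2.1
  · rw [hy, mul_eq_zero, or_iff_right (hf _).1.ne']
  · rw [hsum]
    exact (hf v).2.2.1
  · rw [Finset.sum_sub_distrib, ← sum_sum_ite_fiber p w, ← sum_sum_ite_fiber p y,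
      ← Finset.sum_sub_distrib]
    refine Finset.sum_congr rfl fun v _ => ?_
    rw [hsum, ← hs, (hf v).2.2.2]

/-- **Feasible rounding by row/column rescaling (`RoundToFeasible`).**
`G` is a finite bipartite simple graph with edge endpoint maps `el : E → L`, `er : E → R`
(injectively determining each edge).  If `x ≥ 0` has `‖x‖₁ = M > 0` and total overflow
(over both sides of the bipartition) at most `εM`, then scaling each row `u ∈ L` by
`min 1 (1 / rowsum u)` (factor `1` on empty rows) and then each column `v ∈ R` by
`min 1 (1 / colsum v)` (factor `1` on empty columns) produces `x̃` with the same support,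
satisfying `Bᵀx̃ ≤ 1` entrywise, and with `‖x̃ - x‖₁ ≤ 2εM`. -/
theorem stmt_6 {L R E : Type*} [Fintype L] [Fintype R] [Fintype E]
    [DecidableEq L] [DecidableEq R]
    (el : E → L) (er : E → R)
    (hsimple : Function.Injective (fun e => (el e, er e)))
    (x : E → ℝ) (hx : ∀ e, 0 ≤ x e)
    (M : ℝ) (hM : 0 < M) (hM1 : (∑ e, |x e|) = M)
    (ε : ℝ) (hε : 0 ≤ ε)
    (hoverflow :
      (∑ u : L, max ((∑ e, if el e = u then x e else 0) - 1) 0)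
        + (∑ v : R, max ((∑ e, if er e = v then x e else 0) - 1) 0) ≤ ε * M)
    (rsum : L → ℝ) (hrsum : ∀ u, rsum u = ∑ e, if el e = u then x e else 0)
    (rowfac : L → ℝ)
    (hrow0 : ∀ u, rsum u = 0 → rowfac u = 1)
    (hrow : ∀ u, rsum u ≠ 0 → rowfac u = min 1 (1 / rsum u))
    (x' : E → ℝ) (hx' : ∀ e, x' e = rowfac (el e) * x e)
    (csum : R → ℝ) (hcsum : ∀ v, csum v = ∑ e, if er e = v then x' e else 0)
    (colfac : R → ℝ)
    (hcol0 : ∀ v, csum v = 0 → colfac v = 1)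
    (hcol : ∀ v, csum v ≠ 0 → colfac v = min 1 (1 / csum v))
    (xt : E → ℝ) (hxt : ∀ e, xt e = colfac (er e) * x' e) :
    (∀ e, xt e = 0 ↔ x e = 0) ∧
    (∀ u : L, (∑ e, if el e = u then xt e else 0) ≤ 1) ∧
    (∀ v : R, (∑ e, if er e = v then xt e else 0) ≤ 1) ∧
    (∑ e, |xt e - x e|) ≤ 2 * ε * M := by
  obtain ⟨hx'0, hx'x, hsupp', hfeas', hmass'⟩ :=
    capFibers_spec el x hx rsum hrsum rowfac hrow0 hrow x' hx'
  obtain ⟨-, hxtx', hsupp, hfeas, hmass⟩ :=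
    capFibers_spec er x' hx'0 csum hcsum colfac hcol0 hcol xt hxt
  refine ⟨fun e => (hsupp e).trans (hsupp' e),
    fun u => (sum_ite_fiber_mono el hxtx' u).trans (hfeas' u), hfeas, ?_⟩
  have hcols : (∑ v : R, max ((∑ e, if er e = v then x' e else 0) - 1) 0)
      ≤ ∑ v : R, max ((∑ e, if er e = v then x e else 0) - 1) 0 :=
    Finset.sum_le_sum fun v _ =>
      max_le_max_right 0 (sub_le_sub_right (sum_ite_fiber_mono er hx'x v) 1)
  have habs : (∑ e, |xt e - x e|) = (∑ e, (x e - x' e)) + ∑ e, (x' e - xt e) := by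
    rw [← Finset.sum_add_distrib]
    refine Finset.sum_congr rfl fun e _ => ?_
    rw [abs_of_nonpos (by linarith [hxtx' e, hx'x e])]
    ring
  have hεM : 0 ≤ ε * M := mul_nonneg hε hM.le
  rw [habs, hmass', hmass]
  linarith
end

section
/- Let G = (V,E,w) be a finite undirected graph with positive edge weights w, signed incidence matrix B ∈ {−1,0,1}^{E×V} (each edge row has a +1 at one endpoint and a −1 at the other, for an arbitrary fixed orientation), and W := diag(w). Call d ∈ ℝ^V routable if there exists f ∈ ℝ^E with BᵀW^{−1}f = d, and for routable d define opt(d) := min{‖f‖₁ : f ∈ ℝ^E, BᵀW^{−1}f = d}. Let R ∈ ℝ^{K×V} satisfy opt(d') ≤ ‖Rd'‖₁ for every routable d'. Fix a routable d ∈ ℝ^V and t ≥ 0. Then: (i) if t ≥ opt(d), there exists f with ‖f‖₁ ≤ t and ‖R BᵀW^{−1}f − Rd‖₁ = 0, so the minimum of ‖R BᵀW^{−1}f − Rd‖₁ over {f : ‖f‖₁ ≤ t} is 0; (ii) for every f with ‖f‖₁ ≤ t, ‖R BᵀW^{−1}f − Rd‖₁ ≥ opt(d) − t; in particular if t < opt(d)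 that minimum is at least opt(d) − t. -/
/-- On a nonempty fibre of a continuous map, the `ℓ¹` norm attains its minimum. -/
theorem exists_isLeast_sum_abs_of_continuous {E Y : Type*} [Fintype E] [TopologicalSpace Y]
    [T1Space Y] {T : (E → ℝ) → Y} (hT : Continuous T) (f₀ : E → ℝ) :
    ∃ f : E → ℝ, T f = T f₀ ∧
      IsLeast {val | ∃ f : E → ℝ, T f = T f₀ ∧ val = ∑ e, |f e|} (∑ e, |f e|) := by
  have hclosed : IsClosed {f | T f = T f₀} := isClosed_singleton.preimage hT
  have hcont : Continuous fun f : E → ℝ => ∑ e, |f e| := by fun_prop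
  have hnorm (f : E → ℝ) : ‖f‖ ≤ ∑ e, |f e| :=
    (pi_norm_le_iff_of_nonneg (Finset.sum_nonneg fun e _ => abs_nonneg (f e))).2 fun e =>
      Finset.single_le_sum (f := fun e => |f e|) (fun e _ => abs_nonneg (f e))
        (Finset.mem_univ e)
  have hcoercive : Filter.Tendsto (fun f : E → ℝ => ∑ e, |f e|)
      (Filter.cocompact (E → ℝ)) Filter.atTop :=
    Filter.tendsto_atTop_mono hnorm (tendsto_norm_cocompact_atTop (E := E → ℝ))
  obtain ⟨f, hf, hmin⟩ := hcont.continuousOn.exists_isMinOn' hclosed (x₀ := f₀) rfl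
    ((hcoercive.eventually_ge_atTop _).filter_mono inf_le_left)
  refine ⟨f, hf, ⟨f, hf, rfl⟩, ?_⟩
  rintro _ ⟨g, hg, rfl⟩
  exact hmin hg

/-- **Value of the flow-constrained transshipment problem (Lemma on `opt(d)`).**
`G = (V,E,w)` is a finite weighted undirected graph with positive weights, signed
incidence matrix `Bs`, and routing operator `T f = BsᵀW⁻¹f` (here `(T f) v = Σ_e Bs_{e,v} f_e / w_e`).
`R` satisfies `opt(d') ≤ ‖R d'‖₁` for every routable demand `d'` (expressed with
`IsLeast` characterizing the attained optimum).  For a routable demand `d` with optimum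
`optd` and any `t ≥ 0`:
(i) if `t ≥ optd` the minimum of `‖R(T f - d)‖₁` over `{f : ‖f‖₁ ≤ t}` is attained and is `0`;
(ii) every `f` with `‖f‖₁ ≤ t` has `‖R(T f - d)‖₁ ≥ optd - t`. -/
theorem stmt_7 {V E K : Type*} [Fintype V] [Fintype E] [Fintype K] [DecidableEq V]
    (ends : E → V × V) (hends : ∀ e, (ends e).1 ≠ (ends e).2)
    (Bs : Matrix E V ℝ)
    (hBs : ∀ e v, Bs e v = if v = (ends e).1 then 1 else if v = (ends e).2 then -1 else 0)
    (w : E → ℝ) (hw : ∀ e, 0 < w e)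
    (T : (E → ℝ) → V → ℝ)
    (hT : ∀ f v, T f v = ∑ e, Bs e v * (f e / w e))
    (R : Matrix K V ℝ)
    (hR : ∀ (d' : V → ℝ) (o : ℝ),
      IsLeast {val | ∃ f : E → ℝ, T f = d' ∧ val = ∑ e, |f e|} o →
      o ≤ ∑ k, |∑ v, R k v * d' v|)
    (d : V → ℝ) (optd : ℝ)
    (hoptd : IsLeast {val | ∃ f : E → ℝ, T f = d ∧ val = ∑ e, |f e|} optd)
    (t : ℝ) (ht : 0 ≤ t) :
    (optd ≤ t →
      IsLeast {val | ∃ f : E → ℝ, (∑ e, |f e|) ≤ t ∧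
        val = ∑ k, |∑ v, R k v * (T f v - d v)|} 0) ∧
    (∀ f : E → ℝ, (∑ e, |f e|) ≤ t →
      optd - t ≤ ∑ k, |∑ v, R k v * (T f v - d v)|) := by
  have hadd (f g : E → ℝ) : T (f + g) = T f + T g := by
    ext v
    simp only [hT, Pi.add_apply, ← Finset.sum_add_distrib]
    exact Finset.sum_congr rfl fun e _ => by ring
  have hcont : Continuous T := by
    have h : T = fun f v => ∑ e, Bs e v * (f e / w e) := by ext f v; exact hT f v
    rw [h]
    fun_prop
  obtain ⟨⟨f₀, hf₀, rfl⟩, hmin⟩ := hoptd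
  refine ⟨fun h => ⟨⟨f₀, h, by simp [hf₀]⟩, ?_⟩, fun f hf => ?_⟩
  · rintro _ ⟨f, -, rfl⟩
    positivity
  · obtain ⟨g, hg, hleast⟩ := exists_isLeast_sum_abs_of_continuous hcont (f₀ - f)
    have hresidual : f + (f₀ - f) = f₀ := add_sub_cancel f f₀
    have hroute : T f + T (f₀ - f) = d := by rw [← hadd, hresidual, hf₀]
    have hopt := hmin ⟨f + g, by rw [hadd, hg, hroute], rfl⟩
    have htriangle : ∑ e, |(f + g) e| ≤ ∑ e, |f e| + ∑ e, |g e| := by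
      rw [← Finset.sum_add_distrib]
      exact Finset.sum_le_sum fun e _ => abs_add_le (f e) (g e)
    have hbound := hR _ _ hleast
    have hneg : ∑ k, |∑ v, R k v * (T f v - d v)| = ∑ k, |∑ v, R k v * T (f₀ - f) v| := by
      refine Finset.sum_congr rfl fun k _ => ?_
      rw [← abs_neg, ← Finset.sum_neg_distrib]
      congr 1
      refine Finset.sum_congr rfl fun v _ => ?_
      rw [← hroute, Pi.add_apply]
      ring
    linarith
end

section
/- Let G = (V,E) be a finite bipartite graph with unsigned incidence matrix B, n := |V| ≥ 3, m := |E| ≥ max(3, 4·log(mn)). Let ε satisfy 8·log(mn)/n ≤ ε ≤ 1/2 and set μ := ε/(4·log(mn)). Define f_μ(x) := Σ_{v∈V} x_v + μ·( Σ_{e∈E} exp((1 − [Bx]_e)/μ) + Σ_{v∈V} exp(−(x_v + ε/4)/μ) ) for x ∈ ℝ^V. Then for any x ∈ ℝ^V with f_μ(x) < m, one has [Bx]_e ≥ 1 − ε/2 for every e ∈ E and x_v ≥ −ε/2 for every v ∈ V. -/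
/-- The regularized vertex term `t + μ exp (-(t + a) / μ)` is at least `-a`. -/
theorem neg_le_add_mul_exp {μ : ℝ} (hμ : 0 < μ) (a t : ℝ) :
    -a ≤ t + μ * Real.exp (-(t + a) / μ) := by
  have h := mul_le_mul_of_nonneg_left (Real.add_one_le_exp (-(t + a) / μ)) hμ.le
  have h2 : μ * (-(t + a) / μ + 1) = -(t + a) + μ := by field_simp
  linarith

/-- Left of `-2a`, the regularized vertex term is at least its value at `-2a`. -/
theorem neg_two_mul_add_le_add_mul_exp {μ a t : ℝ} (hμ : 0 < μ) (ha : 0 ≤ a)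
    (ht : t ≤ -(2 * a)) :
    -(2 * a) + μ * Real.exp (a / μ) ≤ t + μ * Real.exp (-(t + a) / μ) := by
  have hsplit : Real.exp (-(t + a) / μ)
      = Real.exp (a / μ) * Real.exp (-(t + 2 * a) / μ) := by
    rw [← Real.exp_add]
    congr 1
    ring
  have hone : 1 ≤ Real.exp (a / μ) := Real.one_le_exp (by positivity)
  have h := mul_le_mul_of_nonneg_left (Real.add_one_le_exp (-(t + 2 * a) / μ))
    (mul_pos hμ (Real.exp_pos (a / μ))).le
  have h2 : μ * Real.exp (a / μ) * (-(t + 2 * a) / μ + 1)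
      = Real.exp (a / μ) * (-(t + 2 * a)) + μ * Real.exp (a / μ) := by field_simp
  rw [hsplit]
  nlinarith [mul_nonneg (sub_nonneg.2 hone) (by linarith : 0 ≤ -(t + 2 * a))]

/-- **Near-feasibility from small potential value (first claim of Lemma `VC-relaxed`).**
`G = (V, E)` is a finite bipartite graph (endpoint maps `ends`, bipartition `L`),
`n = |V| ≥ 3`, `m = |E| ≥ max 3 (4 log (mn))`, `8 log(mn)/n ≤ ε ≤ 1/2` and
`μ = ε / (4 log (mn))`.  For the regularized vertex-cover potential
`f_μ(x) = Σ_v x_v + μ (Σ_e exp((1 - [Bx]_e)/μ) + Σ_v exp(-(x_v + ε/4)/μ))`,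
any `x` with `f_μ(x) < m` satisfies `[Bx]_e ≥ 1 - ε/2` for all edges and `x_v ≥ -ε/2`
for all vertices. -/
theorem stmt_11 {V E : Type*} [Fintype V] [Fintype E]
    (ends : E → V × V) (L : Set V)
    (hbip : ∀ e, (ends e).1 ∈ L ∧ (ends e).2 ∉ L)
    (n m : ℕ) (hn : n = Fintype.card V) (hm : m = Fintype.card E)
    (hn3 : 3 ≤ n) (hm3 : 3 ≤ m)
    (hmlog : 4 * Real.log ((m : ℝ) * n) ≤ (m : ℝ))
    (ε μ : ℝ)
    (hεlow : 8 * Real.log ((m : ℝ) * n) / n ≤ ε) (hεhigh : ε ≤ 1/2)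
    (hμ : μ = ε / (4 * Real.log ((m : ℝ) * n)))
    (fμ : (V → ℝ) → ℝ)
    (hfμ : ∀ x, fμ x = (∑ v, x v)
        + μ * ((∑ e, Real.exp ((1 - (x (ends e).1 + x (ends e).2)) / μ))
            + ∑ v, Real.exp (-(x v + ε/4) / μ))) :
    ∀ x : V → ℝ, fμ x < (m : ℝ) →
      (∀ e, 1 - ε/2 ≤ x (ends e).1 + x (ends e).2) ∧ (∀ v, -(ε/2) ≤ x v) := by
  intro x hx
  have hnR : (3 : ℝ) ≤ n := by exact_mod_cast hn3
  have hmR : (3 : ℝ) ≤ m := by exact_mod_cast hm3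
  have hmn : (9 : ℝ) ≤ (m : ℝ) * n := by nlinarith
  set l := Real.log ((m : ℝ) * n) with hl
  have hlpos : 0 < l := Real.log_pos (by linarith)
  have hεpos : 0 < ε := lt_of_lt_of_le (by positivity) hεlow
  have hμpos : 0 < μ := by rw [hμ]; positivity
  have hεμ : ε = 4 * l * μ := by rw [hμ]; field_simp
  have hμn : 2 ≤ μ * n := by
    rw [div_le_iff₀ (by positivity), hεμ] at hεlow
    nlinarith
  have hexp : Real.exp (ε / 4 / μ) = m * n := by
    have : ε / 4 / μ = l := by rw [hεμ]; field_simp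
    rw [this, hl, Real.exp_log (by linarith)]
  have hμm : ε ≤ μ * m := by rw [hεμ]; nlinarith
  have hμmn : n * ε ≤ μ * (m * n) := by nlinarith
  have hμmn' : 2 * (m : ℝ) ≤ μ * (m * n) := by nlinarith
  have hg (v : V) : 0 ≤ x v + μ * Real.exp (-(x v + ε / 4) / μ) + ε / 4 := by
    linarith [neg_le_add_mul_exp hμpos (ε / 4) (x v)]
  have hsum : ∑ v, (x v + μ * Real.exp (-(x v + ε / 4) / μ) + ε / 4)
      = (∑ v, x v) + μ * (∑ v, Real.exp (-(x v + ε / 4) / μ)) + n * (ε / 4) := by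
    rw [Finset.sum_add_distrib, Finset.sum_add_distrib, ← Finset.mul_sum, Finset.sum_const,
      Finset.card_univ, ← hn, nsmul_eq_mul]
  rw [hfμ, mul_add] at hx
  refine ⟨fun e => ?_, fun v => ?_⟩
  · by_contra! h
    have hV := Finset.sum_nonneg fun v (_ : v ∈ Finset.univ) => hg v
    have hE := Finset.single_le_sum
      (f := fun e => Real.exp ((1 - (x (ends e).1 + x (ends e).2)) / μ))
      (fun e _ => (Real.exp_pos _).le) (Finset.mem_univ e)
    have he : ((m : ℝ) * n) * (m * n)
        ≤ Real.exp ((1 - (x (ends e).1 + x (ends e).2)) / μ) := by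
      rw [← hexp, ← Real.exp_add, ← add_div]
      gcongr
      linarith
    have hE' := mul_le_mul_of_nonneg_left (he.trans hE) hμpos.le
    nlinarith
  · by_contra! h
    have hV := Finset.single_le_sum
      (f := fun v => x v + μ * Real.exp (-(x v + ε / 4) / μ) + ε / 4)
      (fun v _ => hg v) (Finset.mem_univ v)
    have hv := neg_two_mul_add_le_add_mul_exp hμpos (by positivity : 0 ≤ ε / 4)
      (by linarith : x v ≤ -(2 * (ε / 4)))
    rw [hexp] at hv
    have hE : 0 ≤ μ * ∑ e, Real.exp ((1 - (x (ends e).1 + x (ends e).2)) / μ) := by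
      exact mul_nonneg hμpos.le (Finset.sum_nonneg fun e _ => (Real.exp_pos _).le)
    rw [hsum] at hV
    nlinarith
end

section
/- Let G = (V,E) be a finite bipartite graph with unsigned incidence matrix B, n := |V| ≥ 3, m := |E| ≥ 3, with maximum matching size M* ≥ 1. Let ε satisfy 8·log(mn)/n ≤ ε ≤ 1/2 and set μ := ε/(4·log(mn)), and define f_μ(x) := Σ_{v∈V} x_v + μ·( Σ_{e∈E} exp((1 − [Bx]_e)/μ) + Σ_{v∈V} exp(−(x_v + ε/4)/μ) ). Suppose v* ∈ ℝ^V satisfies v* ≥ 0, Bv* ≥ 1 entrywise, and Σ_v v*_v = M* (such v* exists for bipartite G by König's theorem / LP duality). Then the point x := (1 + ε/2)·v* satisfies f_μ(x) ≤ (1 + 2ε/3)·M*. -/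
/-- **Value of the potential at a scaled optimal vertex cover (second claim of
Lemma `VC-relaxed`).** `G = (V, E)` is a finite bipartite graph (endpoint maps `ends`,
bipartition `L`), `n = |V| ≥ 3`, `m = |E| ≥ 3`, with maximum matching size `Mstar ≥ 1`
(the greatest cardinality of a set of pairwise vertex-disjoint edges).  With
`8 log(mn)/n ≤ ε ≤ 1/2`, `μ = ε/(4 log(mn))` and
`f_μ(x) = Σ_v x_v + μ (Σ_e exp((1 - [Bx]_e)/μ) + Σ_v exp(-(x_v + ε/4)/μ))`,
if `v* ≥ 0` satisfies `Bv* ≥ 1` entrywise and `Σ_v v*_v = Mstar` then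
`f_μ((1 + ε/2)·v*) ≤ (1 + 2ε/3)·Mstar`. -/
theorem stmt_12 {V E : Type*} [Fintype V] [Fintype E]
    (ends : E → V × V) (L : Set V)
    (hbip : ∀ e, (ends e).1 ∈ L ∧ (ends e).2 ∉ L)
    (n m : ℕ) (hn : n = Fintype.card V) (hm : m = Fintype.card E)
    (hn3 : 3 ≤ n) (hm3 : 3 ≤ m)
    (Mstar : ℕ)
    (hMstar : IsGreatest {k | ∃ S : Finset E,
      (∀ e ∈ S, ∀ f ∈ S, e ≠ f →
        (ends e).1 ≠ (ends f).1 ∧ (ends e).1 ≠ (ends f).2 ∧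
        (ends e).2 ≠ (ends f).1 ∧ (ends e).2 ≠ (ends f).2) ∧ S.card = k} Mstar)
    (hM1 : 1 ≤ Mstar)
    (ε μ : ℝ)
    (hεlow : 8 * Real.log ((m : ℝ) * n) / n ≤ ε) (hεhigh : ε ≤ 1/2)
    (hμ : μ = ε / (4 * Real.log ((m : ℝ) * n)))
    (fμ : (V → ℝ) → ℝ)
    (hfμ : ∀ x, fμ x = (∑ v, x v)
        + μ * ((∑ e, Real.exp ((1 - (x (ends e).1 + x (ends e).2)) / μ))
            + ∑ v, Real.exp (-(x v + ε/4) / μ)))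
    (vstar : V → ℝ) (hvpos : ∀ v, 0 ≤ vstar v)
    (hvcover : ∀ e, 1 ≤ vstar (ends e).1 + vstar (ends e).2)
    (hvsum : (∑ v, vstar v) = (Mstar : ℝ)) :
    fμ (fun v => (1 + ε/2) * vstar v) ≤ (1 + 2*ε/3) * (Mstar : ℝ) := by
  have hm3' : (3 : ℝ) ≤ m := by exact_mod_cast hm3
  have hn3' : (3 : ℝ) ≤ n := by exact_mod_cast hn3
  have hM1' : (1 : ℝ) ≤ Mstar := by exact_mod_cast hM1
  have hP9 : (9 : ℝ) ≤ m * n := by nlinarith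
  have hP0 : (0 : ℝ) < m * n := by linarith
  have hexpT : Real.exp (Real.log ((m : ℝ) * n)) = m * n := Real.exp_log hP0
  have hT1 : 1 ≤ Real.log ((m : ℝ) * n) := by
    rw [Real.le_log_iff_exp_le hP0]
    linarith [Real.exp_one_lt_d9]
  set T := Real.log ((m : ℝ) * n) with hT
  have hT0 : 0 < T := by linarith
  have hε0 : 0 < ε := lt_of_lt_of_le (by positivity) hεlow
  have hμ0 : 0 < μ := by rw [hμ]; positivity
  have hμT : 4 * (T * μ) = ε := by rw [hμ]; field_simp
  have hμε : μ ≤ ε / 4 := by nlinarith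
  have hinv : Real.exp (-T) = 1 / (m * n) := by rw [Real.exp_neg, hexpT, one_div]
  have hedge : ∀ e, Real.exp ((1 - ((1 + ε/2) * vstar (ends e).1
      + (1 + ε/2) * vstar (ends e).2)) / μ) ≤ 1 / (m * n) * (1 / (m * n)) := by
    intro e
    rw [← hinv, ← Real.exp_add]
    apply Real.exp_le_exp.mpr
    rw [div_le_iff₀ hμ0]
    nlinarith [hvcover e]
  have hvertex : ∀ v, Real.exp (-((1 + ε/2) * vstar v + ε/4) / μ) ≤ 1 / (m * n) := by
    intro v
    rw [← hinv]
    apply Real.exp_le_exp.mpr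
    rw [div_le_iff₀ hμ0]
    nlinarith [hvpos v, mul_nonneg hε0.le (hvpos v)]
  have hedgeSum := Finset.sum_le_card_nsmul Finset.univ _ _ fun e _ => hedge e
  have hvertexSum := Finset.sum_le_card_nsmul Finset.univ _ _ fun v _ => hvertex v
  rw [Finset.card_univ, ← hm, nsmul_eq_mul] at hedgeSum
  rw [Finset.card_univ, ← hn, nsmul_eq_mul] at hvertexSum
  have hedgeBound : (m : ℝ) * (1 / (m * n) * (1 / (m * n))) ≤ 1 / 27 := by
    have : (m : ℝ) * (1 / (m * n) * (1 / (m * n))) = 1 / (m * n * n) := by field_simp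
    rw [this]
    exact one_div_le_one_div_of_le (by norm_num) (by nlinarith)
  have hvertexBound : (n : ℝ) * (1 / (m * n)) ≤ 1 / 3 := by
    have : (n : ℝ) * (1 / (m * n)) = 1 / m := by field_simp
    rw [this]
    exact one_div_le_one_div_of_le (by norm_num) hm3'
  rw [hfμ, ← Finset.mul_sum, hvsum]
  have hpenalty := mul_le_mul_of_nonneg_left
    (add_le_add (hedgeSum.trans hedgeBound) (hvertexSum.trans hvertexBound)) hμ0.le
  nlinarith
end

section
/- Let G = (V,E) be a finite bipartite graph with unsigned incidence matrix B, n := |V| ≥ 3, m := |E| ≥ 3, with maximum matching size M*. Let ε satisfy 8·log(mn)/n ≤ ε ≤ 1/2 and set μ := ε/(4·log(mn)), and define f_μ(x) := Σ_{v∈V} x_v + μ·( Σ_{e∈E} exp((1 − [Bx]_e)/μ) + Σ_{v∈V} exp(−(x_v + ε/4)/μ) ). Then f_μ(x) ≥ M* − εn for every x ∈ ℝ^V. -/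
/-- A separable lower bound: `x + μ exp ((c - x) / μ) ≥ c`. -/
theorem le_add_mul_exp_sub_div {μ : ℝ} (hμ : 0 < μ) (c x : ℝ) :
    c ≤ x + μ * Real.exp ((c - x) / μ) := by
  have h := mul_le_mul_of_nonneg_left (Real.add_one_le_exp ((c - x) / μ)) hμ.le
  rw [mul_add, mul_div_cancel₀ _ hμ.ne'] at h
  linarith


/-- **Global lower bound on the potential (third claim of Lemma `VC-relaxed`).**
`G = (V, E)` is a finite bipartite graph (endpoint maps `ends`, bipartition `L`),
`n = |V| ≥ 3`, `m = |E| ≥ 3`, with maximum matching size `Mstar` (the greatest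
cardinality of a set of pairwise vertex-disjoint edges).  With `8 log(mn)/n ≤ ε ≤ 1/2`,
`μ = ε/(4 log(mn))` and
`f_μ(x) = Σ_v x_v + μ (Σ_e exp((1 - [Bx]_e)/μ) + Σ_v exp(-(x_v + ε/4)/μ))`,
every `x ∈ ℝ^V` satisfies `f_μ(x) ≥ Mstar - εn`. -/
theorem stmt_13 {V E : Type*} [Fintype V] [Fintype E]
    (ends : E → V × V) (L : Set V)
    (hbip : ∀ e, (ends e).1 ∈ L ∧ (ends e).2 ∉ L)
    (n m : ℕ) (hn : n = Fintype.card V) (hm : m = Fintype.card E)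
    (hn3 : 3 ≤ n) (hm3 : 3 ≤ m)
    (Mstar : ℕ)
    (hMstar : IsGreatest {k | ∃ S : Finset E,
      (∀ e ∈ S, ∀ f ∈ S, e ≠ f →
        (ends e).1 ≠ (ends f).1 ∧ (ends e).1 ≠ (ends f).2 ∧
        (ends e).2 ≠ (ends f).1 ∧ (ends e).2 ≠ (ends f).2) ∧ S.card = k} Mstar)
    (ε μ : ℝ)
    (hεlow : 8 * Real.log ((m : ℝ) * n) / n ≤ ε) (hεhigh : ε ≤ 1/2)
    (hμ : μ = ε / (4 * Real.log ((m : ℝ) * n)))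
    (fμ : (V → ℝ) → ℝ)
    (hfμ : ∀ x, fμ x = (∑ v, x v)
        + μ * ((∑ e, Real.exp ((1 - (x (ends e).1 + x (ends e).2)) / μ))
            + ∑ v, Real.exp (-(x v + ε/4) / μ))) :
    ∀ x : V → ℝ, (Mstar : ℝ) - ε * n ≤ fμ x := by
  classical
  intro x
  obtain ⟨S, hS, rfl⟩ := hMstar.1
  have hn3' : (3 : ℝ) ≤ n := by exact_mod_cast hn3
  have hm3' : (3 : ℝ) ≤ m := by exact_mod_cast hm3
  have hlog : 0 < Real.log ((m : ℝ) * n) := Real.log_pos (by nlinarith)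
  have hε : 0 < ε := lt_of_lt_of_le (by positivity) hεlow
  have hμ_pos : 0 < μ := by rw [hμ]; positivity
  have hfst : Set.InjOn (fun e => (ends e).1) (S : Set E) := fun e he f hf h => by
    by_contra hne
    exact (hS e he f hf hne).1 h
  have hsnd : Set.InjOn (fun e => (ends e).2) (S : Set E) := fun e he f hf h => by
    by_contra hne
    exact (hS e he f hf hne).2.2.2 h
  have hdisj : Disjoint (S.image fun e => (ends e).1) (S.image fun e => (ends e).2) := by
    rw [Finset.disjoint_left]
    intro v hv hv'
    obtain ⟨e, -, rfl⟩ := Finset.mem_image.1 hv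
    obtain ⟨f, -, hf⟩ := Finset.mem_image.1 hv'
    exact (hbip f).2 (hf ▸ (hbip e).1)
  have hvert : ∑ e ∈ S, (x (ends e).1 + x (ends e).2)
      ≤ ∑ v, (x v + μ * Real.exp (-(x v + ε/4) / μ) + ε/4) := by
    calc ∑ e ∈ S, (x (ends e).1 + x (ends e).2)
        = ∑ v ∈ (S.image fun e => (ends e).1) ∪ (S.image fun e => (ends e).2), x v := by
          rw [Finset.sum_union hdisj, Finset.sum_image hfst, Finset.sum_image hsnd,
            Finset.sum_add_distrib]
      _ ≤ ∑ v ∈ (S.image fun e => (ends e).1) ∪ (S.image fun e => (ends e).2),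
            (x v + μ * Real.exp (-(x v + ε/4) / μ) + ε/4) := by
          refine Finset.sum_le_sum fun v _ => ?_
          have : 0 ≤ μ * Real.exp (-(x v + ε/4) / μ) := by positivity
          linarith
      _ ≤ _ := by
          refine Finset.sum_le_univ_sum_of_nonneg fun v => ?_
          have h := le_add_mul_exp_sub_div hμ_pos (-(ε/4)) (x v)
          rw [show -(ε/4) - x v = -(x v + ε/4) by ring] at h
          linarith
  have hedge : (S.card : ℝ) ≤ ∑ e ∈ S, (x (ends e).1 + x (ends e).2)
      + μ * ∑ e, Real.exp ((1 - (x (ends e).1 + x (ends e).2)) / μ) := by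
    calc (S.card : ℝ) = ∑ e ∈ S, (1 : ℝ) := by simp
      _ ≤ ∑ e ∈ S, (x (ends e).1 + x (ends e).2
            + μ * Real.exp ((1 - (x (ends e).1 + x (ends e).2)) / μ)) :=
          Finset.sum_le_sum fun e _ => le_add_mul_exp_sub_div hμ_pos _ _
      _ = ∑ e ∈ S, (x (ends e).1 + x (ends e).2)
            + μ * ∑ e ∈ S, Real.exp ((1 - (x (ends e).1 + x (ends e).2)) / μ) := by
          rw [Finset.sum_add_distrib, Finset.mul_sum]
      _ ≤ _ := by
          refine add_le_add le_rfl (mul_le_mul_of_nonneg_left ?_ hμ_pos.le)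
          exact Finset.sum_le_univ_sum_of_nonneg fun e => (Real.exp_pos _).le
  simp only [Finset.sum_add_distrib, ← Finset.mul_sum, Finset.sum_const, Finset.card_univ, ← hn,
    nsmul_eq_mul] at hvert hedge
  rw [hfμ, mul_add]
  have : 0 < ε * n := by positivity
  linarith
end

section
/- Let G = (V,E) be a finite bipartite graph with bipartition V = L ∪ R and oriented incidence matrix B̃ (+1 on L-endpoints, −1 on R-endpoints of each edge). Fix μ > 0 and ε ∈ ℝ, and for x ∈ ℝ^V define y(x) ∈ ℝ^E by y(x)_e := exp((1 − [B̃x]_e)/μ), and z(x) ∈ ℝ^V by z(x)_v := exp(−(x_v + ε/4)/μ) for v ∈ L and z(x)_v := exp((x_v − ε/4)/μ) for v ∈ R. Let H(x) := (1/μ)·( diag(z(x)) + B̃ᵀ diag(y(x)) B̃ ). Then for any x, x' ∈ ℝ^V with ‖x − x'‖_∞ ≤ μ/2, one has the Loewner-order sandwich e^{−1}·H(x) ⪯ H(x') ⪯ e·H(x), i.e., e^{−1}·δᵀH(x)δ ≤ δᵀH(x')δ ≤ e·δᵀH(x)δ for every δ ∈ ℝ^V. -/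
/-- Exponentials of `a / μ` and `b / μ` differ by at most a factor `e` when `b - a ≤ μ`. -/
theorem Real.exp_div_le_exp_one_mul_exp_div {μ a b : ℝ} (hμ : 0 < μ) (h : b ≤ a + μ) :
    Real.exp (b / μ) ≤ Real.exp 1 * Real.exp (a / μ) := by
  rw [← Real.exp_add, Real.exp_le_exp, div_le_iff₀ hμ, add_mul, div_mul_cancel₀ _ hμ.ne']
  linarith

/-- **Second-order robustness of the regularized vertex-cover Hessian.**
`G` is a finite bipartite graph on vertex set `L ⊕ R` with edges `ends : E → L × R`
and oriented incidence matrix `B̃` (`+1` on `L`-endpoints, `-1` on `R`-endpoints).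
For `μ > 0` and `ε ∈ ℝ`, define `y(x)_e = exp((1 - [B̃x]_e)/μ)`,
`z(x)` piecewise by `exp(-(x_v + ε/4)/μ)` on `L` and `exp((x_v - ε/4)/μ)` on `R`,
and the Hessian quadratic form
`Q x δ = (1/μ)(Σ_v z(x)_v δ_v² + Σ_e y(x)_e (δ_{u_e} - δ_{v_e})²)`.
If `‖x - x'‖_∞ ≤ μ/2` then `e⁻¹ Q x δ ≤ Q x' δ ≤ e Q x δ` for every `δ`. -/
theorem stmt_16 {L R E : Type*} [Fintype L] [Fintype R] [Fintype E]
    (ends : E → L × R)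
    (μ : ℝ) (hμ : 0 < μ) (ε : ℝ)
    (y : (L ⊕ R → ℝ) → E → ℝ)
    (hy : ∀ x e, y x e =
      Real.exp ((1 - (x (Sum.inl (ends e).1) - x (Sum.inr (ends e).2))) / μ))
    (z : (L ⊕ R → ℝ) → L ⊕ R → ℝ)
    (hzL : ∀ x u, z x (Sum.inl u) = Real.exp (-(x (Sum.inl u) + ε/4) / μ))
    (hzR : ∀ x v, z x (Sum.inr v) = Real.exp ((x (Sum.inr v) - ε/4) / μ))
    (Q : (L ⊕ R → ℝ) → (L ⊕ R → ℝ) → ℝ)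
    (hQ : ∀ x δ, Q x δ = (1/μ) * ((∑ v, z x v * (δ v)^2)
        + ∑ e, y x e * (δ (Sum.inl (ends e).1) - δ (Sum.inr (ends e).2))^2))
    (x x' : L ⊕ R → ℝ) (hclose : ∀ v, |x v - x' v| ≤ μ/2) :
    ∀ δ : L ⊕ R → ℝ,
      (Real.exp 1)⁻¹ * Q x δ ≤ Q x' δ ∧ Q x' δ ≤ Real.exp 1 * Q x δ := by
  have upper : ∀ a b : L ⊕ R → ℝ, (∀ v, |a v - b v| ≤ μ / 2) →
      ∀ δ, Q b δ ≤ Real.exp 1 * Q a δ := by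
    intro a b hab δ
    have hz : ∀ v, z b v ≤ Real.exp 1 * z a v := by
      rintro (u | v)
      · rw [hzL, hzL]
        apply Real.exp_div_le_exp_one_mul_exp_div hμ
        linarith [(abs_le.mp (hab (Sum.inl u))).2]
      · rw [hzR, hzR]
        apply Real.exp_div_le_exp_one_mul_exp_div hμ
        linarith [(abs_le.mp (hab (Sum.inr v))).1]
    have hy' : ∀ e, y b e ≤ Real.exp 1 * y a e := by
      intro e
      rw [hy, hy]
      apply Real.exp_div_le_exp_one_mul_exp_div hμ
      linarith [(abs_le.mp (hab (Sum.inl (ends e).1))).2,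
        (abs_le.mp (hab (Sum.inr (ends e).2))).1]
    rw [hQ, hQ, mul_left_comm (Real.exp 1), mul_add (Real.exp 1), Finset.mul_sum, Finset.mul_sum]
    simp only [← mul_assoc (Real.exp 1)]
    gcongr with v _ e _
    · exact hz v
    · exact hy' e
  intro δ
  refine ⟨?_, upper x x' hclose δ⟩
  rw [inv_mul_le_iff₀ (Real.exp_pos 1)]
  exact upper x' x (fun v => abs_sub_comm (x v) (x' v) ▸ hclose v) δ
end

section
/- Let f : ℝ^n → ℝ be convex and twice continuously differentiable, let r > 0, and suppose f is r-second-order robust: for all u, v ∈ ℝ^n with ‖u − v‖_∞ ≤ r and all w ∈ ℝ^n, e^{−1}·wᵀ∇²f(u)w ≤ wᵀ∇²f(v)w ≤ e·wᵀ∇²f(u)w. Let x* be a global minimizer of f. Fix x ∈ ℝ^n, and let M be a symmetric matrix with (1/2)·wᵀ∇²f(x)w ≤ wᵀMw ≤ 2·wᵀ∇²f(x)w for all w. Let k ≥ 1 and R ≥ r with ‖x‖_∞ ≤ R and ‖x*‖_∞ ≤ R. Suppose Δ ∈ ℝ^n satisfies ‖Δ‖_∞ ≤ rk and (1/k)·⟨∇f(x),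 Δ⟩ + (e/k²)·ΔᵀMΔ ≤ (1/2)·inf{ (1/k)·⟨∇f(x), y⟩ + (e/k²)·yᵀMy : ‖y‖_∞ ≤ r }. Then x' := x + Δ/k satisfies f(x') − f(x*) ≤ (1 − r/(160·k·R)) · (f(x) − f(x*)). -/
/-- A function on `ℝ` whose second derivative is at most `C` on `[0, 1]` satisfies the
second-order Taylor upper bound at `1`. -/
theorem le_taylor_of_second_deriv_le {φ φ' φ'' : ℝ → ℝ} {C : ℝ}
    (h1 : ∀ t, HasDerivAt φ (φ' t) t) (h2 : ∀ t, HasDerivAt φ' (φ'' t) t)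
    (hC : ∀ t ∈ Set.Icc (0 : ℝ) 1, φ'' t ≤ C) :
    φ 1 ≤ φ 0 + φ' 0 + C / 2 := by
  have hd : ∀ t ∈ Set.Icc (0 : ℝ) 1, φ' t ≤ φ' 0 + C * t := by
    have hder : ∀ t, HasDerivAt (fun t => φ' t - C * t) (φ'' t - C) t := fun t => by
      exact ((h2 t).sub ((hasDerivAt_id t).const_mul C)).congr_deriv (by ring)
    have hanti : AntitoneOn (fun t => φ' t - C * t) (Set.Icc 0 1) :=
      antitoneOn_of_hasDerivWithinAt_nonpos (convex_Icc 0 1)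
        (fun t _ => (hder t).continuousAt.continuousWithinAt)
        (fun t _ => (hder t).hasDerivWithinAt)
        (fun t ht => by linarith [hC t (interior_subset ht)])
    intro t ht
    have := hanti (Set.left_mem_Icc.2 zero_le_one) ht ht.1
    simp only [mul_zero] at this
    linarith
  have hder : ∀ t, HasDerivAt (fun t => φ t - φ' 0 * t - C / 2 * t ^ 2)
      (φ' t - φ' 0 - C * t) t := fun t => by
    exact (((h1 t).sub ((hasDerivAt_id t).const_mul (φ' 0))).sub
      ((hasDerivAt_pow 2 t).const_mul (C / 2))).congr_deriv (by push_cast; ring)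
  have hanti : AntitoneOn (fun t => φ t - φ' 0 * t - C / 2 * t ^ 2) (Set.Icc 0 1) :=
    antitoneOn_of_hasDerivWithinAt_nonpos (convex_Icc 0 1)
      (fun t _ => (hder t).continuousAt.continuousWithinAt)
      (fun t _ => (hder t).hasDerivWithinAt)
      (fun t ht => by linarith [hd t (interior_subset ht)])
  have := hanti (Set.left_mem_Icc.2 zero_le_one) (Set.right_mem_Icc.2 zero_le_one) zero_le_one
  norm_num at this
  linarith

/-- A function on `ℝ` whose second derivative is at least `C` on `[0, 1]` satisfies the
second-order Taylor lower bound at `1`. -/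
theorem taylor_le_of_le_second_deriv {φ φ' φ'' : ℝ → ℝ} {C : ℝ}
    (h1 : ∀ t, HasDerivAt φ (φ' t) t) (h2 : ∀ t, HasDerivAt φ' (φ'' t) t)
    (hC : ∀ t ∈ Set.Icc (0 : ℝ) 1, C ≤ φ'' t) :
    φ 0 + φ' 0 + C / 2 ≤ φ 1 := by
  have := le_taylor_of_second_deriv_le (C := -C) (fun t => (h1 t).neg) (fun t => (h2 t).neg)
    (fun t ht => neg_le_neg (hC t ht))
  simp only [Pi.neg_apply] at this
  linarith

/-- Scaling of a quadratic form given by a matrix of coefficients. -/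
theorem sum_sum_smul_mul_smul {ι : Type*} [Fintype ι] (A : ι → ι → ℝ) (c : ℝ) (w : ι → ℝ) :
    ∑ i, ∑ j, (c * w i) * A i j * (c * w j) = c ^ 2 * ∑ i, ∑ j, w i * A i j * w j := by
  simp only [Finset.mul_sum]
  exact Finset.sum_congr rfl fun i _ => Finset.sum_congr rfl fun j _ => by ring

/-- If `Q₁` and `Q₂` bound the second derivative of a `C²` function in direction `z` along
the segment from `x` to `x + z`, they give two-sided second-order Taylor bounds. -/
theorem taylor_bounds_of_second_fderiv_bounds {E : Type*} [NormedAddCommGroup E]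
    [NormedSpace ℝ E] {f : E → ℝ} (hf : ContDiff ℝ 2 f) (x z : E) {Q₁ Q₂ : ℝ}
    (hQ : ∀ t ∈ Set.Icc (0 : ℝ) 1,
      Q₁ ≤ fderiv ℝ (fun y => fderiv ℝ f y z) (x + t • z) z ∧
        fderiv ℝ (fun y => fderiv ℝ f y z) (x + t • z) z ≤ Q₂) :
    f x + fderiv ℝ f x z + Q₁ / 2 ≤ f (x + z) ∧
      f (x + z) ≤ f x + fderiv ℝ f x z + Q₂ / 2 := by
  have hline : ∀ t : ℝ, HasDerivAt (fun t : ℝ => x + t • z) z t := fun t => by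
    simpa using ((hasDerivAt_id t).smul_const z).const_add x
  have h1 : ∀ t : ℝ, HasDerivAt (fun t : ℝ => f (x + t • z)) (fderiv ℝ f (x + t • z) z) t :=
    fun t => ((hf.differentiable two_ne_zero) _).hasFDerivAt.comp_hasDerivAt t (hline t)
  have hdf : Differentiable ℝ (fun y => fderiv ℝ f y z) :=
    ((hf.fderiv_right (m := 1) (by norm_num)).differentiable one_ne_zero).clm_apply
      (differentiable_const z)
  have h2 : ∀ t : ℝ, HasDerivAt (fun t : ℝ => fderiv ℝ f (x + t • z) z)
      (fderiv ℝ (fun y => fderiv ℝ f y z) (x + t • z) z) t :=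
    fun t => (hdf _).hasFDerivAt.comp_hasDerivAt t (hline t)
  have hlow := taylor_le_of_le_second_deriv h1 h2 fun t ht => (hQ t ht).1
  have hupp := le_taylor_of_second_deriv_le h1 h2 fun t ht => (hQ t ht).2
  simp only [zero_smul, add_zero, one_smul] at hlow hupp
  exact ⟨hlow, hupp⟩


/-- **Progress of one box-constrained Newton step (Lemma `boxnewton`).**
`f : ℝ^ι → ℝ` is convex and `C²` with gradient `g` and Hessian `H` (encoded via
`fderiv`), and is `r`-second-order robust: the Hessian quadratic form changes by at most
a factor `e` when the argument moves by at most `r` in `ℓ∞`.  Let `x*` be a global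
minimizer, `M` a symmetric 2-spectral approximation of `H x`, `k ≥ 1`, `R ≥ r`, and
suppose `‖x‖_∞, ‖x*‖_∞ ≤ R`.  If `Δ` has `‖Δ‖_∞ ≤ rk` and achieves at most half the
minimum over the `ℓ∞` ball of radius `r` of the quadratic model
`y ↦ (1/k)⟨g x, y⟩ + (e/k²) yᵀMy`, then
`f(x + Δ/k) - f(x*) ≤ (1 - r/(160 k R)) (f(x) - f(x*))`. -/
theorem stmt_17 {ι : Type*} [Fintype ι]
    (f : (ι → ℝ) → ℝ) (hC2 : ContDiff ℝ 2 f)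
    (hconv : ConvexOn ℝ Set.univ f)
    (g : (ι → ℝ) → (ι → ℝ))
    (hg : ∀ x v, fderiv ℝ f x v = ∑ i, g x i * v i)
    (H : (ι → ℝ) → ι → ι → ℝ)
    (hH : ∀ x v w, fderiv ℝ (fun y => fderiv ℝ f y w) x v
        = ∑ i, ∑ j, v i * H x i j * w j)
    (r : ℝ) (hr : 0 < r)
    (hrobust : ∀ u v : ι → ℝ, (∀ i, |u i - v i| ≤ r) → ∀ w : ι → ℝ,
      (Real.exp 1)⁻¹ * (∑ i, ∑ j, w i * H u i j * w j) ≤ (∑ i, ∑ j, w i * H v i j * w j) ∧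
      (∑ i, ∑ j, w i * H v i j * w j) ≤ Real.exp 1 * (∑ i, ∑ j, w i * H u i j * w j))
    (xstar : ι → ℝ) (hmin : ∀ y, f xstar ≤ f y)
    (x : ι → ℝ)
    (M : ι → ι → ℝ) (hMsymm : ∀ i j, M i j = M j i)
    (hM : ∀ w : ι → ℝ,
      (1/2) * (∑ i, ∑ j, w i * H x i j * w j) ≤ (∑ i, ∑ j, w i * M i j * w j) ∧
      (∑ i, ∑ j, w i * M i j * w j) ≤ 2 * (∑ i, ∑ j, w i * H x i j * w j))
    (k R : ℝ) (hk : 1 ≤ k) (hrR : r ≤ R)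
    (hxR : ∀ i, |x i| ≤ R) (hxsR : ∀ i, |xstar i| ≤ R)
    (Δ : ι → ℝ) (hΔnorm : ∀ i, |Δ i| ≤ r * k)
    (hΔ : ∀ y : ι → ℝ, (∀ i, |y i| ≤ r) →
      (1/k) * (∑ i, g x i * Δ i) + (Real.exp 1 / k^2) * (∑ i, ∑ j, Δ i * M i j * Δ j)
        ≤ (1/2) * ((1/k) * (∑ i, g x i * y i)
            + (Real.exp 1 / k^2) * (∑ i, ∑ j, y i * M i j * y j))) :
    f (fun i => x i + Δ i / k) - f xstar
      ≤ (1 - r / (160 * k * R)) * (f x - f xstar) := by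
  have he : 1 ≤ Real.exp 1 := Real.one_le_exp zero_le_one
  have he2 : Real.exp 1 ^ 2 ≤ 10 := by nlinarith [Real.exp_one_lt_d9]
  have hk0 : 0 < k := by linarith
  have hR0 : 0 < R := by linarith
  have hQ0 : ∀ w : ι → ℝ, 0 ≤ ∑ i, ∑ j, w i * H x i j * w j := fun w => by
    have := (hrobust x x (fun i => by simpa using hr.le) w).2
    nlinarith [Real.add_one_lt_exp (one_ne_zero (α := ℝ))]
  have taylor : ∀ z : ι → ℝ, (∀ i, |z i| ≤ r) →
      f x + (∑ i, g x i * z i) + ((Real.exp 1)⁻¹ * ∑ i, ∑ j, z i * H x i j * z j) / 2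
          ≤ f (x + z) ∧
        f (x + z) ≤ f x + (∑ i, g x i * z i)
          + (Real.exp 1 * ∑ i, ∑ j, z i * H x i j * z j) / 2 := fun z hz => by
    have := taylor_bounds_of_second_fderiv_bounds hC2 x z
      (Q₁ := (Real.exp 1)⁻¹ * ∑ i, ∑ j, z i * H x i j * z j)
      (Q₂ := Real.exp 1 * ∑ i, ∑ j, z i * H x i j * z j) fun t ht => by
        rw [hH]
        refine hrobust x (x + t • z) (fun i => ?_) z
        simp only [Pi.add_apply, Pi.smul_apply, smul_eq_mul, sub_add_cancel_left, abs_neg,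
          abs_mul, abs_of_nonneg ht.1]
        exact (mul_le_of_le_one_left (abs_nonneg _) ht.2).trans (hz i)
    rwa [hg] at this
  have hstep : f (fun i => x i + Δ i / k) ≤ f x + ((1/k) * (∑ i, g x i * Δ i)
      + (Real.exp 1 / k^2) * (∑ i, ∑ j, Δ i * M i j * Δ j)) := by
    have h := (taylor (fun i => (1 / k) * Δ i) fun i => by
      rw [abs_mul, abs_of_pos (by positivity), one_div, inv_mul_le_iff₀ hk0, mul_comm]
      exact hΔnorm i).2
    have hx : (x + fun i => (1 / k) * Δ i) = fun i => x i + Δ i / k := by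
      ext i
      simp only [Pi.add_apply]
      ring
    have hlin : ∑ i, g x i * ((1 / k) * Δ i) = (1 / k) * ∑ i, g x i * Δ i := by
      rw [Finset.mul_sum]
      exact Finset.sum_congr rfl fun i _ => by ring
    rw [hx, hlin, sum_sum_smul_mul_smul (H x)] at h
    have hM' := mul_le_mul_of_nonneg_left (hM Δ).1
      (by positivity : 0 ≤ Real.exp 1 / k ^ 2)
    refine h.trans ?_
    calc _ = f x + ((1 / k) * (∑ i, g x i * Δ i) + Real.exp 1 / k ^ 2 *
          (1 / 2 * ∑ i, ∑ j, Δ i * H x i j * Δ j)) := by ring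
      _ ≤ _ := by linarith
  -- Lower bound for the point `x + z` on the segment towards `xstar`.
  set s : ℝ := r / (2 * R) with hs
  have hs0 : 0 < s := by positivity
  have hs1 : s ≤ 1 := by rw [hs, div_le_one (by positivity)]; linarith
  set z : ι → ℝ := fun i => s * (xstar i - x i) with hz
  have hzr : ∀ i, |z i| ≤ r := fun i => by
    have h1 : |xstar i - x i| ≤ 2 * R := by
      have := abs_sub (xstar i) (x i)
      linarith [hxR i, hxsR i]
    calc |z i| = s * |xstar i - x i| := by rw [hz, abs_mul, abs_of_pos hs0]
      _ ≤ s * (2 * R) := by gcongr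
      _ = r := by rw [hs]; field_simp
  have hfz : f (x + z) ≤ f x - s * (f x - f xstar) := by
    have h := hconv.2 (Set.mem_univ x) (Set.mem_univ xstar) (sub_nonneg.2 hs1) hs0.le
      (by ring)
    have hxz : (1 - s) • x + s • xstar = x + z := by
      ext i
      simp only [hz, Pi.add_apply, Pi.smul_apply, smul_eq_mul]
      ring
    rw [hxz, smul_eq_mul, smul_eq_mul] at h
    linarith
  have hzlow := (taylor z hzr).1
  -- Compare with the model at the scaled direction `c * z`.
  set c : ℝ := 1 / (4 * Real.exp 1 ^ 2) with hc
  have hc0 : 0 < c := by positivity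
  have hc1 : c ≤ 1 := by
    rw [hc, div_le_one (by positivity)]
    nlinarith
  have hy := hΔ (fun i => c * z i) fun i => by
    rw [abs_mul, abs_of_pos hc0]
    exact (mul_le_of_le_one_left (abs_nonneg _) hc1).trans (hzr i)
  have hlin : ∑ i, g x i * (c * z i) = c * ∑ i, g x i * z i := by
    rw [Finset.mul_sum]
    exact Finset.sum_congr rfl fun i _ => by ring
  rw [hlin, sum_sum_smul_mul_smul M] at hy
  have hMz := (hM z).2
  have hQz := hQ0 z
  have hD : 0 ≤ f x - f xstar := sub_nonneg.2 (hmin x)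
  generalize (∑ i, ∑ j, z i * H x i j * z j) = Q at *
  generalize (∑ i, ∑ j, z i * M i j * z j) = m at *
  generalize (∑ i, g x i * z i) = G at *
  have hmodel : (1 / k) * (c * G) + (Real.exp 1 / k ^ 2) * (c ^ 2 * m)
      ≤ (c / k) * (-(s * (f x - f xstar))) := by
    have h1 : (Real.exp 1 * c / k) * m ≤ (Real.exp 1)⁻¹ * Q / 2 := by
      calc (Real.exp 1 * c / k) * m ≤ (Real.exp 1 * c / k) * (2 * Q) := by gcongr
        _ ≤ (Real.exp 1 * c) * (2 * Q) := by
          gcongr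
          exact div_le_self (by positivity) hk
        _ = (Real.exp 1)⁻¹ * Q / 2 := by rw [hc]; field_simp; norm_num
    calc _ = (c / k) * (G + (Real.exp 1 * c / k) * m) := by ring
      _ ≤ _ := by
        gcongr
        linarith
  have hrate : r / (160 * k * R) ≤ (1 / 2) * ((c / k) * s) := by
    have : (1 / 2) * ((c / k) * s) = r / ((16 * Real.exp 1 ^ 2) * k * R) := by
      rw [hc, hs]
      field_simp
      norm_num
    rw [this]
    gcongr
    linarith
  have := mul_le_mul_of_nonneg_right hrate hD
  linarith
end
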